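/- Let $\Gamma$ be a finite group acting by group automorphisms on an abelian group $M$, and write $M^\Gamma = \{m \in M : \tau \cdot m = m \text{ for all } \tau \in \Gamma\}$ for the subgroup of fixed points. Let $e \geq 1$ be an integer such that $e \cdot m = 0$ for every $m \in M^\Gamma$ with $|\Gamma| \cdot m = 0$. If $p \in M$ satisfies $\sigma \cdot p - p \in M^\Gamma$ for every $\sigma \in \Gamma$, then $e \cdot p \in M^\Gamma$. -/

import Mathlib

/-- If `g • x - x` is fixed by `g`, then the powers of `g` translate `x` by multiples of
`g • x - x`. -/
theorem pow_smul_eq_add_nsmul_of_smul_sub_fixed {G A : Type*} [Monoid G] [AddCommGroup A]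
    [DistribMulAction G A] {g : G} {x : A} (h : g • (g • x - x) = g • x - x) (n : ℕ) :
    g ^ n • x = x + n • (g • x - x) := by
  induction n with
  | zero => simp
  | succ n ih =>
    rw [pow_succ', mul_smul, ih, smul_add, smul_comm g n, h, succ_nsmul]
    abel

/-- **Group-theoretic content of Lemma 2.6(b).** Let a finite group `Γ` act by group
automorphisms on an abelian group `M`, and let `e ≥ 1` be an integer killing every fixed
point of `M` that is killed by `|Γ|`. If `p ∈ M` satisfies `σ • p - p ∈ M^Γ` for every
`σ ∈ Γ`, then `e • p ∈ M^Γ`. -/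
theorem smul_nsmul_eq_of_smul_sub_fixed {Γ M : Type*} [Group Γ] [Fintype Γ]
    [AddCommGroup M] [DistribMulAction Γ M]
    (e : ℕ) (he : 1 ≤ e)
    (hkill : ∀ m : M, (∀ τ : Γ, τ • m = m) → (Fintype.card Γ) • m = 0 → e • m = 0)
    (p : M) (hp : ∀ σ τ : Γ, τ • (σ • p - p) = σ • p - p) :
    ∀ σ : Γ, σ • (e • p) = e • p := by
  intro σ
  have hcard : Fintype.card Γ • (σ • p - p) = 0 := by
    have h := pow_smul_eq_add_nsmul_of_smul_sub_fixed (hp σ σ) (Fintype.card Γ)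
    rwa [pow_card_eq_one, one_smul, left_eq_add] at h
  have h := hkill _ (hp σ) hcard
  rwa [nsmul_sub, sub_eq_zero, smul_comm e σ p] at h
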